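/- arXiv:1807.10093 — 3 statements merged into one kernel-verified Lean document; each statement's English description precedes it below -/
import Mathlib

section
/- Let a ∈ ℝ, let I ⊆ ℝ be an interval, let w, v, z, v' ∈ ℝ², and let s, t : ℝ → ℝ be affine maps (i.e., of the form b ↦ c₀ + c₁·b). Define p, q : ℝ → ℝ² by p b = w + (s b) • (v − w) and q b = z + (t b) • (v' − z). Assume that for every b ∈ I: s b ∈ [0,1] and t b ∈ [0,1]; both points p b and q b lie on the line with slope a and intercept b, i.e., (p b)₂ = a·(p b)₁ + b and (q b)₂ = a·(q b)₁ + b; and (p b)₁ ≤ (q b)₁. Then for all constants K₁, K₂ ∈ ℝ there exist c₀, c₁ ∈ ℝ such that K₁ + dist(w, p b) + dist(p b, q b) + dist(q b, z) + K₂ = c₀ + c₁·b for every b ∈ I. -/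
/-- The distance between two points of a line of slope `a` in terms of their first coordinates. -/
theorem EuclideanSpace.dist_eq_of_mem_line {a b : ℝ} {x y : EuclideanSpace ℝ (Fin 2)}
    (hx : x 1 = a * x 0 + b) (hy : y 1 = a * y 0 + b) (hxy : x 0 ≤ y 0) :
    dist x y = √(1 + a ^ 2) * (y 0 - x 0) := by
  rw [EuclideanSpace.dist_eq, Fin.sum_univ_two, Real.dist_eq, Real.dist_eq, sq_abs, sq_abs, hx, hy,
    show (x 0 - y 0) ^ 2 + (a * x 0 + b - (a * y 0 + b)) ^ 2 = (1 + a ^ 2) * (y 0 - x 0) ^ 2 by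
      ring,
    Real.sqrt_mul (by positivity), Real.sqrt_sq (sub_nonneg.2 hxy)]

/-- Lemma 1 of the paper (linearity in the intercept `b`):
If `p b` and `q b` are intersection points of the line `y = a·x + b` with the
edges `wv` and `zv'` (parametrized affinely in `b`), then the function
`K₁ + |w p| + |p q| + |q z| + K₂` is an affine (linear) function of `b` on `I`. -/
theorem eccentricity_function_linear_in_intercept
    (a : ℝ) (I : Set ℝ) (hI : I.OrdConnected)
    (w v z v' : EuclideanSpace ℝ (Fin 2))
    (s t : ℝ → ℝ)
    (hs : ∃ c₀ c₁ : ℝ, ∀ b : ℝ, s b = c₀ + c₁ * b)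
    (ht : ∃ c₀ c₁ : ℝ, ∀ b : ℝ, t b = c₀ + c₁ * b)
    (p q : ℝ → EuclideanSpace ℝ (Fin 2))
    (hp : ∀ b : ℝ, p b = w + s b • (v - w))
    (hq : ∀ b : ℝ, q b = z + t b • (v' - z))
    (hs01 : ∀ b ∈ I, s b ∈ Set.Icc (0 : ℝ) 1)
    (ht01 : ∀ b ∈ I, t b ∈ Set.Icc (0 : ℝ) 1)
    (hpline : ∀ b ∈ I, (p b) 1 = a * (p b) 0 + b)
    (hqline : ∀ b ∈ I, (q b) 1 = a * (q b) 0 + b)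
    (horder : ∀ b ∈ I, (p b) 0 ≤ (q b) 0) :
    ∀ K₁ K₂ : ℝ, ∃ c₀ c₁ : ℝ, ∀ b ∈ I,
      K₁ + dist w (p b) + dist (p b) (q b) + dist (q b) z + K₂ = c₀ + c₁ * b := by
  intro K₁ K₂
  obtain ⟨s₀, s₁, hs⟩ := hs
  obtain ⟨t₀, t₁, ht⟩ := ht
  refine ⟨K₁ + s₀ * ‖v - w‖ + √(1 + a ^ 2) * (z 0 + t₀ * (v' 0 - z 0) - w 0 - s₀ * (v 0 - w 0))
      + t₀ * ‖v' - z‖ + K₂,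
    s₁ * ‖v - w‖ + √(1 + a ^ 2) * (t₁ * (v' 0 - z 0) - s₁ * (v 0 - w 0)) + t₁ * ‖v' - z‖,
    fun b hb => ?_⟩
  have hwp : dist w (p b) = s b * ‖v - w‖ := by
    rw [hp, dist_self_add_right, norm_smul, Real.norm_of_nonneg (hs01 b hb).1]
  have hqz : dist (q b) z = t b * ‖v' - z‖ := by
    rw [hq, dist_self_add_left, norm_smul, Real.norm_of_nonneg (ht01 b hb).1]
  have hp0 : p b 0 = w 0 + s b * (v 0 - w 0) := by simp [hp]
  have hq0 : q b 0 = z 0 + t b * (v' 0 - z 0) := by simp [hq]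
  rw [hwp, hqz, EuclideanSpace.dist_eq_of_mem_line (hpline b hb) (hqline b hb) (horder b hb),
    hp0, hq0, hs, ht]
  ring
end

section
/- Let o, p, q ∈ ℝ² be such that the vectors p − o and q − o are linearly independent, let a = dist(o, p) and b = dist(o, q), and let λ ∈ ℝ with λ ≠ 0. Define p' = o + ((a + λ)/a) • (p − o) and q' = o + ((b + λ)/b) • (q − o). If there exists μ ∈ ℝ with p' − q' = μ • (p − q), then a = b; that is, the segments pq and p'q' are parallel only if the triangle formed by p, q and o is isosceles with dist(o, p) = dist(o, q). -/
/-- Claim from the proof of Theorem 11 of the paper: advancing the endpoints `p`, `q`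
of a segment by the same signed distance `λ` along the rays from `o` through `p` and
through `q` yields a segment `p'q'` parallel to `pq` only if the triangle `p o q` is
isosceles with `dist o p = dist o q`. -/
theorem parallel_advanced_segment_implies_isosceles
    (o p q : EuclideanSpace ℝ (Fin 2))
    (hindep : LinearIndependent ℝ ![p - o, q - o])
    (a b : ℝ) (ha : a = dist o p) (hb : b = dist o q)
    (lam : ℝ) (hlam : lam ≠ 0)
    (p' q' : EuclideanSpace ℝ (Fin 2))
    (hp' : p' = o + ((a + lam) / a) • (p - o))
    (hq' : q' = o + ((b + lam) / b) • (q - o))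
    (hpar : ∃ μ : ℝ, p' - q' = μ • (p - q)) :
    a = b := by
  obtain ⟨μ, hμ⟩ := hpar
  have ha0 : a ≠ 0 := by
    rw [ha, dist_ne_zero]
    rintro rfl
    exact hindep.ne_zero 0 (by simp)
  have hb0 : b ≠ 0 := by
    rw [hb, dist_ne_zero]
    rintro rfl
    exact hindep.ne_zero 1 (by simp)
  have hcomb : ((a + lam) / a - μ) • (p - o) + (μ - (b + lam) / b) • (q - o) = 0 := by
    rw [← sub_eq_zero] at hμ
    rw [← hμ, hp', hq']
    module
  obtain ⟨h₁, h₂⟩ := LinearIndependent.pair_iff.mp hindep _ _ hcomb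
  have hratio : (a + lam) / a = (b + lam) / b := by linarith
  rw [div_eq_div_iff ha0 hb0] at hratio
  apply mul_left_cancel₀ hlam
  linarith
end

section
/- Let k be a positive integer and let E, N : Fin k → ℝ be functions such that N is antitone (i ≤ j implies N j ≤ N i). Let M = { i : Fin k | for all j with i ≤ j, E i ≤ E j } be the set of indices i such that no later index has a strictly smaller E-value. Then M is nonempty, and the minimum over all i ∈ Fin k of max(E i, N i) equals the minimum over i ∈ M of max(E i, N i). -/
/-- Every index is dominated by a later one past which `E` takes no smaller value. -/
theorem exists_ge_forall_ge_le {ι α : Type*} [Preorder ι] [Finite ι] [LinearOrder α]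
    (E : ι → α) (i : ι) : ∃ j, i ≤ j ∧ E j ≤ E i ∧ ∀ l, j ≤ l → E j ≤ E l := by
  obtain ⟨j, hij, hj⟩ :=
    Set.exists_min_image (Set.Ici i) E (Set.toFinite _) ⟨i, le_refl i⟩
  exact ⟨j, hij, hj i (le_refl i), fun l hl => hj l (le_trans hij hl)⟩

/-- Correctness of the binary search in Lemma 6/Theorem 8 of the paper: if `N` is
antitone, then the minimum of `max (E i) (N i)` over all indices is attained over the
set `M` of 'maximal' indices `i` (those with no later index of strictly smaller
`E`-value), and `M` is nonempty. -/
theorem min_max_attained_on_maximal_indices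
    (k : ℕ) (hk : 0 < k) (E N : Fin k → ℝ) (hN : Antitone N)
    (M : Set (Fin k)) (hM : M = {i : Fin k | ∀ j, i ≤ j → E i ≤ E j}) :
    M.Nonempty ∧
    sInf ((fun i => max (E i) (N i)) '' (Set.univ : Set (Fin k))) =
      sInf ((fun i => max (E i) (N i)) '' M) := by
  subst hM
  have hne : {i : Fin k | ∀ j, i ≤ j → E i ≤ E j}.Nonempty := by
    obtain ⟨j, -, -, hj⟩ := exists_ge_forall_ge_le E ⟨0, hk⟩
    exact ⟨j, hj⟩
  refine ⟨hne, le_antisymm ?_ ?_⟩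
  · exact csInf_le_csInf (Set.toFinite _).bddBelow (hne.image _)
      (Set.image_mono (Set.subset_univ _))
  · refine le_csInf ⟨_, ⟨0, hk⟩, Set.mem_univ _, rfl⟩ ?_
    rintro _ ⟨i, -, rfl⟩
    obtain ⟨j, hij, hE, hj⟩ := exists_ge_forall_ge_le E i
    exact csInf_le_of_le (Set.toFinite _).bddBelow ⟨j, hj, rfl⟩
      (max_le_max hE (hN hij))
end
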